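/- For every finite simple graph G = (V,E) and every positive integer k, ch_k(G) ≤ 948·χ(G)·(k + log(|V|/χ(G) + 1)), where χ(G) is the chromatic number of G and log denotes the natural logarithm. -/

import Mathlib

/-- A graph `G` is `(a:b)`-choosable if for every assignment of color sets of size `a`
to the vertices, one can choose subsets of size `b` that are disjoint on adjacent vertices. -/
def SimpleGraph.Choosable {V : Type*} (G : SimpleGraph V) (a b : ℕ) : Prop :=
  ∀ S : V → Finset ℕ, (∀ v, (S v).card = a) →
    ∃ C : V → Finset ℕ, (∀ v, C v ⊆ S v) ∧ (∀ v, (C v).card = b) ∧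
      ∀ u v, G.Adj u v → Disjoint (C u) (C v)

/-- The `k`-th choice number of `G`: the least `n` such that `G` is `(n:k)`-choosable. -/
noncomputable def SimpleGraph.chooseNum {V : Type*} (G : SimpleGraph V) (k : ℕ) : ℕ :=
  sInf {n | G.Choosable n k}

/-- Exponential moment of the number of colors of `S` that a uniformly random map sends to `B`. -/
lemma sum_half_pow_card_filter_le {α β : Type*} [Fintype α] [DecidableEq α] [Fintype β]
    [DecidableEq β] [Nonempty β] (S : Finset α) (B : Finset β) :
    ∑ f : α → β, (1 / 2 : ℝ) ^ (S.filter fun c => f c ∈ B).card ≤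
      (Fintype.card (α → β) : ℝ) *
        Real.exp (-((S.card : ℝ) * (B.card / (2 * Fintype.card β)))) := by
  have hβ : (0 : ℝ) < Fintype.card β := by exact_mod_cast Fintype.card_pos
  have hterm : ∀ f : α → β, (1 / 2 : ℝ) ^ (S.filter fun c => f c ∈ B).card =
      ∏ c, if c ∈ S then (if f c ∈ B then (1 / 2 : ℝ) else 1) else 1 := by
    intro f
    rw [Finset.prod_ite_mem, Finset.univ_inter, ← Finset.prod_filter, Finset.prod_const]
  have hB : ∑ b : β, (if b ∈ B then (1 / 2 : ℝ) else 1) =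
      Fintype.card β * (1 - B.card / (2 * Fintype.card β)) := by
    have h : ∀ b : β, (if b ∈ B then (1 / 2 : ℝ) else 1) = 1 - if b ∈ B then (1 / 2 : ℝ) else 0 := by
      intro b
      split_ifs <;> norm_num
    simp only [h, Finset.sum_sub_distrib, Finset.sum_ite_mem, Finset.univ_inter, Finset.sum_const,
      nsmul_eq_mul, Finset.card_univ]
    field_simp
  have hcolor : ∀ c : α, 0 ≤ ∑ b : β, (if c ∈ S then (if b ∈ B then (1 / 2 : ℝ) else 1) else 1) ∧
      ∑ b : β, (if c ∈ S then (if b ∈ B then (1 / 2 : ℝ) else 1) else 1) ≤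
      Fintype.card β * (if c ∈ S then Real.exp (-(B.card / (2 * Fintype.card β))) else 1) := by
    intro c
    refine ⟨Finset.sum_nonneg fun b _ => by split_ifs <;> norm_num, ?_⟩
    by_cases hc : c ∈ S
    · simp only [hc, if_true, hB]
      gcongr
      linarith [Real.add_one_le_exp (-((B.card : ℝ) / (2 * Fintype.card β)))]
    · simp [hc]
  calc ∑ f : α → β, (1 / 2 : ℝ) ^ (S.filter fun c => f c ∈ B).card
      = ∏ c : α, ∑ b : β, (if c ∈ S then (if b ∈ B then (1 / 2 : ℝ) else 1) else 1) := by
        rw [Finset.prod_univ_sum, Fintype.piFinset_univ]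
        exact Finset.sum_congr rfl fun f _ => hterm f
    _ ≤ ∏ c : α, (Fintype.card β : ℝ) *
          (if c ∈ S then Real.exp (-(B.card / (2 * Fintype.card β))) else 1) :=
        Finset.prod_le_prod (fun c _ => (hcolor c).1) fun c _ => (hcolor c).2
    _ = _ := by
        rw [Finset.prod_mul_distrib, Finset.prod_ite_mem, Finset.univ_inter, Finset.prod_const,
          Finset.prod_const, ← Real.exp_nat_mul, Fintype.card_fun, Nat.cast_pow, Finset.card_univ,
          mul_neg]

/-- Sets of size at least `k * T.card` contain pairwise disjoint subsets of size `k`. -/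
lemma exists_pairwiseDisjoint_subsets {V α : Type*} [DecidableEq V] [DecidableEq α]
    (Y : V → Finset α) (k : ℕ) (T : Finset V) (hT : ∀ v ∈ T, k * T.card ≤ (Y v).card) :
    ∃ D : V → Finset α, (∀ v ∈ T, D v ⊆ Y v ∧ (D v).card = k) ∧
      (T : Set V).PairwiseDisjoint D := by
  induction T using Finset.induction_on with
  | empty => exact ⟨fun _ => ∅, by simp⟩
  | insert w T hw ih =>
    rw [Finset.card_insert_of_notMem hw] at hT
    obtain ⟨D, hD, hdisj⟩ := ih fun v hv =>
      (Nat.mul_le_mul_left k (Nat.le_succ _)).trans (hT v (Finset.mem_insert_of_mem hv))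
    have hcard : k ≤ (Y w \ T.biUnion D).card := by
      have h1 : (T.biUnion D).card ≤ T.card * k :=
        Finset.card_biUnion_le_card_mul _ _ _ fun v hv => (hD v hv).2.le
      have h2 := hT w (Finset.mem_insert_self w T)
      have h3 := Finset.le_card_sdiff (T.biUnion D) (Y w)
      rw [mul_add, mul_comm k T.card] at h2
      omega
    obtain ⟨E, hE, hEk⟩ := Finset.exists_subset_card_eq hcard
    have hne : ∀ v ∈ T, v ≠ w := fun v hv h => hw (h ▸ hv)
    have hED : ∀ v ∈ T, Disjoint E (D v) := fun v hv =>
      Finset.disjoint_of_subset_right (Finset.subset_biUnion_of_mem D hv)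
        (Finset.disjoint_of_subset_left hE Finset.sdiff_disjoint)
    refine ⟨Function.update D w E, ?_, ?_⟩
    · intro v hv
      rcases Finset.mem_insert.1 hv with rfl | hv
      · simpa using ⟨hE.trans Finset.sdiff_subset, hEk⟩
      · simpa [hne v hv] using hD v hv
    · intro u hu v hv huv
      have hu' := Finset.mem_insert.1 (Finset.mem_coe.1 hu)
      have hv' := Finset.mem_insert.1 (Finset.mem_coe.1 hv)
      change Disjoint (Function.update D w E u) (Function.update D w E v)
      rcases hu' with rfl | hu' <;> rcases hv' with rfl | hv'
      · exact absurd rfl huv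
      · simpa [hne v hv'] using hED v hv'
      · simpa [hne u hu'] using (hED u hu').symm
      · simpa [hne u hu', hne v hv'] using hdisj hu' hv' huv

/-- A random map from colors to parts, where half of the colors are held in reserve, leaves fewer
than `r` vertices short of colors of their own part, and no vertex short of reserve colors. -/
lemma exists_color_partition {V α : Type*} [Fintype V] [Nonempty V] [Fintype α] [DecidableEq α]
    {r k a : ℕ} (hr : 0 < r) (hk : 0 < k) (p : V → Fin r) (S : V → Finset α)
    (hS : ∀ v, (S v).card = a)
    (ha : 8 * (r : ℝ) * (k + Real.log ((Fintype.card V : ℝ) / r + 1)) ≤ a) :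
    ∃ f : α → Bool × Fin r,
      (Finset.univ.filter fun v => ((S v).filter fun c => f c = (true, p v)).card < k).card < r ∧
      ∀ v, k * r ≤ ((S v).filter fun c => (f c).1 = false).card := by
  have : Nonempty (Fin r) := ⟨⟨0, hr⟩⟩
  have hr1 : (1 : ℝ) ≤ r := by exact_mod_cast hr
  have hk1 : (1 : ℝ) ≤ k := by exact_mod_cast hk
  have hn1 : (1 : ℝ) ≤ Fintype.card V := by exact_mod_cast (Fintype.card_pos (α := V))
  set n : ℝ := (Fintype.card V : ℝ) with hn
  set L : ℝ := Real.log (n / r + 1) with hL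
  have hbase : 0 < n / r + 1 := by positivity
  have hL0 : 0 ≤ L := Real.log_nonneg (by linarith [show 0 ≤ n / r by positivity])
  have hexpL : Real.exp L = n / r + 1 := Real.exp_log hbase
  have hexprL : n + 1 ≤ Real.exp (r * L) := by
    rw [Real.exp_nat_mul, hexpL]
    have h := one_add_mul_le_pow (show (-2 : ℝ) ≤ n / r by linarith [show 0 ≤ n / r by positivity]) r
    rw [mul_div_cancel₀ n (by positivity : (r : ℝ) ≠ 0)] at h
    rwa [add_comm 1 n, add_comm 1 (n / r)] at h
  have he2 : (2 : ℝ) ≤ Real.exp 1 := by linarith [Real.add_one_le_exp (1 : ℝ)]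
  have htwo : ∀ m : ℕ, (2 : ℝ) ^ m ≤ Real.exp m := by
    intro m
    calc (2 : ℝ) ^ m ≤ Real.exp 1 ^ m := by gcongr
      _ = Real.exp m := by rw [← Real.exp_nat_mul, mul_one]
  let X : (α → Bool × Fin r) → V → Finset α := fun f v =>
    (S v).filter fun c => f c ∈ ({(true, p v)} : Finset (Bool × Fin r))
  let Y : (α → Bool × Fin r) → V → Finset α := fun f v =>
    (S v).filter fun c => f c ∈ ({false} ×ˢ Finset.univ : Finset (Bool × Fin r))
  set N : ℝ := (Fintype.card (α → Bool × Fin r) : ℝ) with hN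
  have hNpos : 0 < N := by rw [hN]; exact_mod_cast Fintype.card_pos
  have hX : ∀ v, ∑ f, (2 : ℝ) ^ k / r * (1 / 2) ^ (X f v).card ≤ N * (1 / (2 * (n + r))) := by
    intro v
    rw [← Finset.mul_sum]
    have h := sum_half_pow_card_filter_le (S v) ({(true, p v)} : Finset (Bool × Fin r))
    have hexp : Real.exp (-((a : ℝ) * (1 / (2 * (2 * r))))) ≤
        Real.exp (-(k : ℝ)) * (Real.exp (-1) * Real.exp (-L)) := by
      rw [← Real.exp_add, ← Real.exp_add]
      apply Real.exp_le_exp.2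
      have : 2 * ((k : ℝ) + L) ≤ (a : ℝ) * (1 / (2 * (2 * r))) := by
        rw [mul_one_div, le_div_iff₀ (by positivity)]
        linarith
      linarith
    simp only [Finset.card_singleton, Fintype.card_prod, Fintype.card_bool, Fintype.card_fin, hS,
      Nat.cast_mul, Nat.cast_one, Nat.cast_ofNat] at h
    have h1 : Real.exp (-1) ≤ 1 / 2 := by
      rw [Real.exp_neg, one_div]
      exact inv_anti₀ (by norm_num) he2
    have h2 : Real.exp (-L) = r / (n + r) := by
      rw [Real.exp_neg, hexpL]
      field_simp
    calc (2 : ℝ) ^ k / r * ∑ f, (1 / 2 : ℝ) ^ (X f v).card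
        ≤ Real.exp k / r * (N * (Real.exp (-(k : ℝ)) * (1 / 2 * (r / (n + r))))) := by
          gcongr
          · exact htwo k
          · refine h.trans ?_
            gcongr
            refine hexp.trans ?_
            rw [h2]
            gcongr
      _ = N * (1 / (2 * (n + r))) := by
          rw [Real.exp_neg]
          field_simp
  have hY : ∀ v, ∑ f, (2 : ℝ) ^ (k * r) * (1 / 2) ^ (Y f v).card ≤ N * (1 / (2 * (n + 1))) := by
    intro v
    rw [← Finset.mul_sum]
    have h := sum_half_pow_card_filter_le (S v) ({false} ×ˢ Finset.univ : Finset (Bool × Fin r))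
    have hexp : Real.exp (-((a : ℝ) * (r / (2 * (2 * r))))) ≤
        Real.exp (-((k * r : ℕ) : ℝ)) * (Real.exp (-1) * Real.exp (-(r * L))) := by
      rw [← Real.exp_add, ← Real.exp_add]
      apply Real.exp_le_exp.2
      have h1 : (a : ℝ) * (r / (2 * (2 * r))) = a / 4 := by field_simp; norm_num
      have h2 : 1 ≤ (r : ℝ) * k := one_le_mul_of_one_le_of_one_le hr1 hk1
      have h3 : 0 ≤ (r : ℝ) * L := by positivity
      rw [h1]
      push_cast
      linarith
    simp only [Finset.card_product, Finset.card_singleton, Finset.card_univ, one_mul,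
      Fintype.card_prod, Fintype.card_bool, Fintype.card_fin, hS, Nat.cast_mul,
      Nat.cast_ofNat] at h
    have h1 : Real.exp (-1) ≤ 1 / 2 := by
      rw [Real.exp_neg, one_div]
      exact inv_anti₀ (by norm_num) he2
    have h2 : Real.exp (-(r * L)) ≤ 1 / (n + 1) := by
      rw [Real.exp_neg, one_div]
      exact inv_anti₀ (by positivity) hexprL
    calc (2 : ℝ) ^ (k * r) * ∑ f, (1 / 2 : ℝ) ^ (Y f v).card
        ≤ Real.exp ((k * r : ℕ) : ℝ) *
            (N * (Real.exp (-((k * r : ℕ) : ℝ)) * (1 / 2 * (1 / (n + 1))))) := by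
          gcongr
          · exact htwo _
          · refine h.trans ?_
            gcongr
            refine hexp.trans ?_
            gcongr
      _ = N * (1 / (2 * (n + 1))) := by
          rw [Real.exp_neg]
          field_simp
  obtain ⟨f, hf⟩ : ∃ f, ∑ v, ((2 : ℝ) ^ k / r * (1 / 2) ^ (X f v).card +
      (2 : ℝ) ^ (k * r) * (1 / 2) ^ (Y f v).card) < 1 := by
    obtain ⟨f, -, hf⟩ := Finset.exists_lt_of_sum_lt (s := Finset.univ)
      (f := fun f => ∑ v, ((2 : ℝ) ^ k / r * (1 / 2) ^ (X f v).card +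
        (2 : ℝ) ^ (k * r) * (1 / 2) ^ (Y f v).card)) (g := fun _ => (1 : ℝ)) (by
      rw [Finset.sum_comm]
      simp only [Finset.sum_add_distrib, Finset.sum_const, Finset.card_univ, nsmul_eq_mul, mul_one]
      calc _ ≤ ∑ _v : V, N * (1 / (2 * (n + r))) + ∑ _v : V, N * (1 / (2 * (n + 1))) :=
            add_le_add (Finset.sum_le_sum fun v _ => hX v) (Finset.sum_le_sum fun v _ => hY v)
        _ = N * (n / (2 * (n + r)) + n / (2 * (n + 1))) := by
            simp only [Finset.sum_const, Finset.card_univ, nsmul_eq_mul, ← hn]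
            ring
        _ < N * 1 := by
            have h1 : n / (2 * (n + r)) < 1 / 2 := by
              rw [div_lt_div_iff₀ (by positivity) (by norm_num)]
              linarith
            have h2 : n / (2 * (n + 1)) < 1 / 2 := by
              rw [div_lt_div_iff₀ (by positivity) (by norm_num)]
              linarith
            gcongr
            linarith
        _ = N := mul_one N)
    exact ⟨f, hf⟩
  have hXnonneg : ∀ v, 0 ≤ (2 : ℝ) ^ k / r * (1 / 2) ^ (X f v).card := fun v => by positivity
  have hYnonneg : ∀ v, 0 ≤ (2 : ℝ) ^ (k * r) * (1 / 2) ^ (Y f v).card := fun v => by positivity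
  have hpow : ∀ s t : ℕ, s < t → (1 : ℝ) ≤ 2 ^ t * (1 / 2) ^ s := by
    intro s t hst
    rw [one_div, inv_pow, ← div_eq_mul_inv, one_le_div (by positivity)]
    exact pow_le_pow_right₀ (by norm_num) hst.le
  refine ⟨f, ?_, ?_⟩
  · have hXf : ∀ v, ((S v).filter fun c => f c = (true, p v)) = X f v := fun v => by simp [X]
    simp only [hXf]
    have hle : ((Finset.univ.filter fun v => (X f v).card < k).card : ℝ) * (1 / r) < 1 := by
      refine lt_of_le_of_lt ?_ hf
      calc ((Finset.univ.filter fun v => (X f v).card < k).card : ℝ) * (1 / r)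
          = ∑ v ∈ Finset.univ.filter fun v => (X f v).card < k, (1 / r : ℝ) := by
            rw [Finset.sum_const, nsmul_eq_mul]
        _ ≤ ∑ v ∈ Finset.univ.filter fun v => (X f v).card < k,
              ((2 : ℝ) ^ k / r * (1 / 2) ^ (X f v).card +
                (2 : ℝ) ^ (k * r) * (1 / 2) ^ (Y f v).card) := by
            refine Finset.sum_le_sum fun v hv => ?_
            have h := hpow _ _ (Finset.mem_filter.1 hv).2
            calc (1 / r : ℝ) ≤ (2 ^ k * (1 / 2) ^ (X f v).card) / r := by gcongr
              _ = (2 : ℝ) ^ k / r * (1 / 2) ^ (X f v).card := by ring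
              _ ≤ _ := le_add_of_nonneg_right (hYnonneg v)
        _ ≤ _ := Finset.sum_le_sum_of_subset_of_nonneg (Finset.subset_univ _) fun v _ _ =>
            add_nonneg (hXnonneg v) (hYnonneg v)
    rw [mul_one_div, div_lt_one (by positivity)] at hle
    exact_mod_cast hle
  · intro v
    have hYf : ((S v).filter fun c => (f c).1 = false) = Y f v := by
      ext c
      simp only [Y, Finset.mem_filter, Finset.mem_product, Finset.mem_singleton, Finset.mem_univ,
        and_true]
    rw [hYf]
    by_contra! hlt
    have h1 := hpow _ _ hlt
    have h2 := Finset.single_le_sum (f := fun v => (2 : ℝ) ^ k / r * (1 / 2) ^ (X f v).card +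
      (2 : ℝ) ^ (k * r) * (1 / 2) ^ (Y f v).card)
      (fun v _ => add_nonneg (hXnonneg v) (hYnonneg v)) (Finset.mem_univ v)
    have h3 := hXnonneg v
    linarith

lemma SimpleGraph.choosable_of_coloring {V : Type*} [Fintype V] [Nonempty V] (G : SimpleGraph V)
    {r k a : ℕ} (hr : 0 < r) (hk : 0 < k) (p : G.Coloring (Fin r))
    (ha : 8 * (r : ℝ) * (k + Real.log ((Fintype.card V : ℝ) / r + 1)) ≤ a) :
    G.Choosable a k := by
  classical
  intro S hS
  have hSU : ∀ v, ∀ c ∈ S v, c ∈ Finset.univ.biUnion S := fun v c hc =>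
    Finset.mem_biUnion.2 ⟨v, Finset.mem_univ v, hc⟩
  let S' : V → Finset (Finset.univ.biUnion S) := fun v => (S v).subtype (· ∈ Finset.univ.biUnion S)
  have hS'map : ∀ v, (S' v).map (Function.Embedding.subtype _) = S v := fun v =>
    Finset.subtype_map_of_mem (hSU v)
  have hS' : ∀ v, (S' v).card = a := fun v => by
    rw [← hS v, ← hS'map v, Finset.card_map]
  obtain ⟨f, hbad, hres⟩ := exists_color_partition hr hk p S' hS' ha
  set T := Finset.univ.filter fun v => ((S' v).filter fun c => f c = (true, p v)).card < k with hT
  obtain ⟨D, hD, hdisj⟩ := exists_pairwiseDisjoint_subsets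
    (fun v => (S' v).filter fun c => (f c).1 = false) k T fun v _ =>
      (Nat.mul_le_mul_left k hbad.le).trans (hres v)
  have hgood : ∀ v, v ∉ T → ∃ E ⊆ (S' v).filter fun c => f c = (true, p v), E.card = k := by
    intro v hv
    refine Finset.exists_subset_card_eq (not_lt.1 fun h => hv ?_)
    exact Finset.mem_filter.2 ⟨Finset.mem_univ v, h⟩
  choose! E hE hEk using hgood
  have hmix : ∀ u v, u ∈ T → v ∉ T → Disjoint (D u) (E v) := by
    intro u v hu hv
    refine Finset.disjoint_left.2 fun c hc hc' => ?_
    have h1 := (Finset.mem_filter.1 ((hD u hu).1 hc)).2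
    have h2 := (Finset.mem_filter.1 (hE v hv hc')).2
    simp [h2] at h1
  refine ⟨fun v => (if v ∈ T then D v else E v).map (Function.Embedding.subtype _), ?_, ?_, ?_⟩
  · intro v
    rw [← hS'map v, Finset.map_subset_map]
    split_ifs with hv
    · exact (hD v hv).1.trans (Finset.filter_subset _ _)
    · exact (hE v hv).trans (Finset.filter_subset _ _)
  · intro v
    rw [Finset.card_map]
    split_ifs with hv
    · exact (hD v hv).2
    · exact hEk v hv
  · intro u v huv
    rw [Finset.disjoint_map]
    split_ifs with hu hv hv
    · exact hdisj hu hv huv.ne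
    · exact hmix u v hu hv
    · exact (hmix v u hv hu).symm
    · refine Finset.disjoint_left.2 fun c hc hc' => p.valid huv ?_
      have h1 := (Finset.mem_filter.1 (hE u hu hc)).2
      have h2 := (Finset.mem_filter.1 (hE v hv hc')).2
      exact (Prod.ext_iff.1 (h1.symm.trans h2)).2

theorem kth_choice_number_le_of_chromaticNumber {V : Type*} [Fintype V]
    (G : SimpleGraph V) (k : ℕ) (hk : 0 < k) :
    (G.chooseNum k : ℝ) ≤ 948 * (G.chromaticNumber.toNat : ℝ) *
      ((k : ℝ) + Real.log ((Fintype.card V : ℝ) / (G.chromaticNumber.toNat : ℝ) + 1)) := by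
  rcases isEmpty_or_nonempty V with hV | hV
  · have h0 : G.chooseNum k ≤ 0 :=
      Nat.sInf_le fun S _ => ⟨S, fun v => isEmptyElim v, fun v => isEmptyElim v,
        fun u => isEmptyElim u⟩
    simp [Nat.le_zero.1 h0]
  · have hcol : G.Colorable G.chromaticNumber.toNat :=
      SimpleGraph.colorable_chromaticNumber G.colorable_of_fintype
    set r := G.chromaticNumber.toNat with hr_def
    obtain ⟨p⟩ := hcol
    have hr : 0 < r := (p (Classical.arbitrary V)).pos
    have hr1 : (1 : ℝ) ≤ r := by exact_mod_cast hr
    have hk1 : (1 : ℝ) ≤ k := by exact_mod_cast hk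
    have hL0 : 0 ≤ Real.log ((Fintype.card V : ℝ) / r + 1) :=
      Real.log_nonneg (le_add_of_nonneg_left (by positivity))
    set L := Real.log ((Fintype.card V : ℝ) / r + 1) with hL
    have hle : G.chooseNum k ≤ ⌈8 * (r : ℝ) * (k + L)⌉₊ :=
      Nat.sInf_le (G.choosable_of_coloring hr hk p (Nat.le_ceil _))
    have hceil := Nat.ceil_lt_add_one (show 0 ≤ 8 * (r : ℝ) * (k + L) by positivity)
    have hrk : 1 ≤ (r : ℝ) * (k + L) := one_le_mul_of_one_le_of_one_le hr1 (by linarith)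
    have hle' : (G.chooseNum k : ℝ) ≤ ⌈8 * (r : ℝ) * (k + L)⌉₊ := by exact_mod_cast hle
    linarith
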